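/- Let p, m, n ∈ ℕ with p ≤ m ≤ n, let λ ∈ ℝ with λ > −1/2 and λ ≠ 0, and let l ∈ {0,…,p+m+n} be such that s := p+m+n−l is odd. Then, writing 𝖥^λ_{k,q,r,t} for the Gegenbauer linearization coefficients (with 𝖥^λ_{k,q,r,t} := 0 when k < 0 or k > ⌊(q+r+t)/2⌋), the following six contiguous relations hold: (1) (m+λ)(p+1)𝖥^λ_{(s+1)/2,p+1,m,n} + (p+2λ−1)(m+λ)𝖥^λ_{(s−1)/2,p−1,m,n} = (p+λ)(m+1)𝖥^λ_{(s+1)/2,p,m+1,n} + (p+λ)(m+2λ−1)𝖥^λ_{(s−1)/2,p,m−1,n}; (2) (n+λ)(p+1)𝖥^λ_{(s+1)/2,p+1,m,n} + (p+2λ−1)(n+λ)𝖥^λ_{(s−1)/2,p−1,m,n} = (p+λ)(n+1)𝖥^λ_{(s+1)/2,p,m,n+1} + (p+λ)(n+2λ−1)𝖥^λ_{(s−1)/2,p,m,n−1}; (3) (p+1)𝖥^λ_{(s+1)/2,p+1,m,n} + (p+2λ−1)𝖥^λ_{(s−1)/2,p−1,m,n} = ((2λ+l)(p+λ)/(λ+l+1))𝖥^λ_{(s−1)/2,p,m,n}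 + (l(p+λ)/(λ+l−1))𝖥^λ_{(s+1)/2,p,m,n}; (4) (n+λ)(m+1)𝖥^λ_{(s+1)/2,p,m+1,n} + (m+2λ−1)(n+λ)𝖥^λ_{(s−1)/2,p,m−1,n} = (m+λ)(n+1)𝖥^λ_{(s+1)/2,p,m,n+1} + (m+λ)(n+2λ−1)𝖥^λ_{(s−1)/2,p,m,n−1}; (5) (m+1)𝖥^λ_{(s+1)/2,p,m+1,n} + (m+2λ−1)𝖥^λ_{(s−1)/2,p,m−1,n} = ((2λ+l)(m+λ)/(λ+l+1))𝖥^λ_{(s−1)/2,p,m,n} + (l(m+λ)/(λ+l−1))𝖥^λ_{(s+1)/2,p,m,n}; (6) (n+1)𝖥^λ_{(s+1)/2,p,m,n+1} + (n+2λ−1)𝖥^λ_{(s−1)/2,p,m,n−1} = ((2λ+l)(n+λ)/(λ+l+1))𝖥^λ_{(s−1)/2,p,m,n} + (l(n+λ)/(λ+l−1))𝖥^λ_{(s+1)/2,p,m,n}. -/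

import Mathlib

open MeasureTheory

/-- Pochhammer symbol `(a)_j` for real `a` and natural `j`. -/
noncomputable def poch (a : ℝ) (j : ℕ) : ℝ := (ascPochhammer ℝ j).eval a

/-- Pochhammer symbol `(a)_j` for integer index, with the convention
`(a)_{-j} = 1/((a-1)(a-2)⋯(a-j))` for `j ≥ 1`. -/
noncomputable def pochZ (a : ℝ) (j : ℤ) : ℝ :=
  if 0 ≤ j then poch a j.toNat
  else (∏ i ∈ Finset.range (-j).toNat, (a - (i + 1)))⁻¹

/-- Factorial of an integer: `j!` for `j ≥ 0` and `0` for `j < 0`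
(encoding `1/(negative integer)! = 0` via Lean's division by zero). -/
noncomputable def ifact (j : ℤ) : ℝ := if 0 ≤ j then (j.toNat.factorial : ℝ) else 0

/-- Generalized hypergeometric sum `ᵣF_s(a; b; z)` (intended for terminating series,
where all terms beyond the termination index vanish). -/
noncomputable def hypSum (a b : List ℝ) (z : ℝ) : ℝ :=
  ∑' j : ℕ, ((a.map fun t => poch t j).prod /
    ((b.map fun t => poch t j).prod * (j.factorial : ℝ))) * z ^ j

/-- Gegenbauer polynomial `C_n^λ(x)`. -/
noncomputable def gegC (lam : ℝ) (n : ℕ) (x : ℝ) : ℝ :=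
  poch (2 * lam) n / n.factorial *
    ∑ j ∈ Finset.range (n + 1),
      poch (-(n : ℝ)) j * poch ((n : ℝ) + 2 * lam) j /
        (poch (lam + 1 / 2) j * j.factorial) * ((1 - x) / 2) ^ j

/-- The coefficient `𝖣^λ_{k,p,m,n}` in the linearization of a product of three
Gegenbauer polynomials. -/
noncomputable def gegD (lam : ℝ) (k p m n : ℤ) : ℝ :=
  (ifact (m + n) * pochZ lam m * pochZ lam n * (lam + (m : ℝ) + n + p - 2 * k) *
      ifact (m + n + p - 2 * k) * pochZ lam k * pochZ lam (p - k) * pochZ lam (m + n - k) *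
      pochZ (2 * lam) (m + n + p - k)) /
    (ifact m * ifact n * pochZ lam (m + n) * (lam + (m : ℝ) + n + p - k) * ifact k *
      ifact (p - k) * ifact (m + n - k) * pochZ lam (m + n + p - k) *
      pochZ (2 * lam) (m + n + p - 2 * k)) *
  hypSum
    [lam, lam + (p : ℝ) - k, -(k : ℝ), -(m : ℝ), -(n : ℝ), -(m : ℝ) - n + k,
      -lam - (m : ℝ) - n, -lam - (m : ℝ) - n - p + k,
      (-lam + 2 - (m : ℝ) - n) / 2, (-2 * lam + 1 - (m : ℝ) - n) / 2,
      (-2 * lam + 2 - (m : ℝ) - n) / 2]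
    [1 + (p : ℝ) - k, -lam + 1 - (k : ℝ), -lam + 1 - (m : ℝ), -lam + 1 - (n : ℝ),
      -lam + 1 - (m : ℝ) - n + k, -2 * lam + 1 - (m : ℝ) - n,
      -2 * lam + 1 - (m : ℝ) - n - p + k,
      (-lam - (m : ℝ) - n) / 2, (-(m : ℝ) - n) / 2, (1 - (m : ℝ) - n) / 2]
    1

/-- The coefficient `𝖤^λ_{k,p,m,n}` in the linearization of a product of three
Gegenbauer polynomials. -/
noncomputable def gegE (lam : ℝ) (k p m n : ℤ) : ℝ :=
  ((lam + (m : ℝ) + n + p - 2 * k) * ifact (m + n + 2 * p - 2 * k) * pochZ lam p *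
      pochZ lam (k - p) * pochZ lam (m + p - k) * pochZ lam (n + p - k) *
      pochZ lam (m + n + p - 2 * k) * pochZ (2 * lam) (m + n + p - k)) /
    ((lam + (m : ℝ) + n + p - k) * ifact p * ifact (k - p) * ifact (m + p - k) *
      ifact (n + p - k) * pochZ lam (m + n + p - k) * pochZ lam (m + n + 2 * p - 2 * k) *
      pochZ (2 * lam) (m + n + p - 2 * k)) *
  hypSum
    [lam, lam + (k : ℝ) - p, -(p : ℝ), -(m : ℝ) - p + k, -(n : ℝ) - p + k,
      -(m : ℝ) - n - p + 2 * k, -lam - (m : ℝ) - n - p + k, -lam - (m : ℝ) - n - 2 * p + 2 * k,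
      (-lam + 2 * (k : ℝ) - 2 * p - m - n + 2) / 2,
      (-2 * lam + 1 + 2 * (k : ℝ) - 2 * p - m - n) / 2,
      (-2 * lam + 2 + 2 * (k : ℝ) - 2 * p - m - n) / 2]
    [1 + (k : ℝ) - p, -lam + 1 - (p : ℝ), -lam + 1 - (m : ℝ) - p + k,
      -lam + 1 - (n : ℝ) - p + k, -lam + 1 - (m : ℝ) - n - p + 2 * k,
      -2 * lam + 1 - (m : ℝ) - n - p + k, -2 * lam + 1 - (m : ℝ) - n - 2 * p + 2 * k,
      (-lam + 2 * (k : ℝ) - 2 * p - m - n) / 2, (2 * (k : ℝ) - 2 * p - m - n) / 2,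
      (1 + 2 * (k : ℝ) - 2 * p - m - n) / 2]
    1

/-- The Gegenbauer linearization coefficient `𝖥^λ_{k,p,m,n}`:
`𝖣` for `0 ≤ k ≤ p-1`, `𝖤` for `p ≤ k ≤ ⌊(p+m+n)/2⌋`, and `0` otherwise. -/
noncomputable def gegF (lam : ℝ) (k p m n : ℤ) : ℝ :=
  if 0 ≤ k ∧ k ≤ p - 1 then gegD lam k p m n
  else if p ≤ k ∧ k ≤ (p + m + n).fdiv 2 then gegE lam k p m n
  else 0

theorem poch_succ (a : ℝ) (j : ℕ) : poch a (j + 1) = poch a j * (a + j) :=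
  ascPochhammer_succ_eval j a

theorem poch_zero_right (a : ℝ) : poch a 0 = 1 := by simp [poch]

theorem poch_neg_eq_zero {a : ℝ} {K j : ℕ} (ha : a = -(K : ℝ)) (h : K < j) : poch a j = 0 := by
  induction j with
  | zero => omega
  | succ j ih =>
    rw [poch_succ]
    rcases Nat.lt_succ_iff_lt_or_eq.mp h with h | h
    · rw [ih h, zero_mul]
    · rw [ha, h, neg_add_cancel, mul_zero]

theorem pochZ_succ (a : ℝ) {j : ℤ} (hj : 0 ≤ j) : pochZ a (j + 1) = pochZ a j * (a + j) := by
  lift j to ℕ using hj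
  have h : (0 : ℤ) ≤ (j : ℤ) + 1 := by omega
  simp only [pochZ, h, if_true, Int.natCast_nonneg, Int.toNat_natCast, Int.toNat_natCast_add_one,
    poch_succ, Int.cast_natCast]

theorem pochZ_zero_right (a : ℝ) : pochZ a 0 = 1 := by simp [pochZ, poch_zero_right]

theorem pochZ_ne_zero {a : ℝ} (h1 : -1 < a) (h2 : a ≠ 0) {j : ℤ} (hj : 0 ≤ j) :
    pochZ a j ≠ 0 := by
  induction j, hj using Int.leInduction with
  | base => simp [pochZ_zero_right]
  | succ j hj ih =>
    rw [pochZ_succ a hj]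
    refine mul_ne_zero ih ?_
    rcases hj.eq_or_lt with h | h
    · simpa [← h] using h2
    · have : (1 : ℝ) ≤ j := by exact_mod_cast h
      linarith

theorem ifact_succ {j : ℤ} (hj : 0 ≤ j) : ifact (j + 1) = (j + 1) * ifact j := by
  lift j to ℕ using hj
  have h : (0 : ℤ) ≤ (j : ℤ) + 1 := by omega
  simp only [ifact, h, if_true, Int.natCast_nonneg, Int.toNat_natCast, Int.toNat_natCast_add_one,
    Nat.factorial_succ]
  push_cast
  ring

theorem ifact_zero : ifact 0 = 1 := by simp [ifact]

theorem ifact_of_neg {j : ℤ} (hj : j < 0) : ifact j = 0 := by simp [ifact, hj]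

theorem ifact_ne_zero {j : ℤ} (hj : 0 ≤ j) : ifact j ≠ 0 := by
  simp [ifact, hj, Nat.factorial_ne_zero]

/-- The power series coefficient `(λ)_a / a!` of `(1 - x)^(-λ)`, zero for negative `a`. -/
noncomputable def pochDivFact (lam : ℝ) (a : ℤ) : ℝ := pochZ lam a / ifact a

/-- The ratio `(2λ)_N / (λ)_N`. -/
noncomputable def pochRatio (lam : ℝ) (N : ℤ) : ℝ := pochZ (2 * lam) N / pochZ lam N

/-- The ratio `M! / (2λ)_M`. -/
noncomputable def factDivPoch (lam : ℝ) (M : ℤ) : ℝ := ifact M / pochZ (2 * lam) M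

theorem pochDivFact_of_neg (lam : ℝ) {a : ℤ} (ha : a < 0) : pochDivFact lam a = 0 := by
  simp [pochDivFact, ifact_of_neg ha]

theorem pochDivFact_zero (lam : ℝ) : pochDivFact lam 0 = 1 := by
  simp [pochDivFact, ifact_zero, pochZ_zero_right]

theorem pochDivFact_succ (lam : ℝ) {a : ℤ} (ha : 0 ≤ a) :
    pochDivFact lam (a + 1) = (lam + a) / (a + 1) * pochDivFact lam a := by
  have := ifact_ne_zero ha
  have h : (a : ℝ) + 1 ≠ 0 := by exact_mod_cast (by omega : a + 1 ≠ 0)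
  rw [pochDivFact, pochDivFact, pochZ_succ lam ha, ifact_succ ha]
  field_simp

theorem add_intCast_ne_zero {lam : ℝ} (h1 : -1 < lam) (h2 : lam ≠ 0) {j : ℤ} (hj : 0 ≤ j) :
    lam + j ≠ 0 := by
  rcases hj.eq_or_lt with h | h
  · simpa [← h] using h2
  · have : (1 : ℝ) ≤ j := by exact_mod_cast h
    linarith

theorem pochRatio_succ {lam : ℝ} (h1 : -(1 / 2) < lam) (h2 : lam ≠ 0) {N : ℤ} (hN : 0 ≤ N) :
    pochRatio lam (N + 1) = (2 * lam + N) / (lam + N) * pochRatio lam N := by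
  have := add_intCast_ne_zero (by linarith) h2 hN
  have := pochZ_ne_zero (by linarith) h2 hN
  rw [pochRatio, pochRatio, pochZ_succ _ hN, pochZ_succ _ hN]
  field_simp

theorem factDivPoch_succ {lam : ℝ} (h1 : -(1 / 2) < lam) (h2 : lam ≠ 0) {M : ℤ} (hM : 0 ≤ M) :
    factDivPoch lam (M + 1) = (M + 1) / (2 * lam + M) * factDivPoch lam M := by
  have := add_intCast_ne_zero (lam := 2 * lam) (by linarith) (by simpa using h2) hM
  have := pochZ_ne_zero (a := 2 * lam) (by linarith) (by simpa using h2) hM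
  rw [factDivPoch, factDivPoch, pochZ_succ _ hM, ifact_succ hM]
  field_simp

/-- The coefficient of `C_{b+c}^λ` in the product `C_{a+b}^λ C_{a+c}^λ` (Dougall's formula). -/
noncomputable def dougall (lam : ℝ) (a b c : ℤ) : ℝ :=
  (lam + (b + c : ℤ)) / (lam + (a + b + c : ℤ)) *
    (pochDivFact lam a * pochDivFact lam b * pochDivFact lam c) *
    (pochRatio lam (a + b + c) * factDivPoch lam (b + c))

theorem dougall_eq_zero (lam : ℝ) {a b c : ℤ} (h : a < 0 ∨ b < 0 ∨ c < 0) :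
    dougall lam a b c = 0 := by
  rcases h with h | h | h <;> simp [dougall, pochDivFact_of_neg lam h]

/-- The recurrence for Dougall's coefficients that corresponds to multiplying the product
`C_{a+b}^λ C_{a+c}^λ` by the variable. -/
theorem dougall_contiguous {lam : ℝ} (h1 : -(1 / 2) < lam) (h2 : lam ≠ 0) {a b c : ℤ}
    (ha : 0 ≤ a) (hbc : 0 ≤ b + c + 1) :
    ((a : ℝ) + b + 1) * dougall lam a (b + 1) c +
        (a + b + 2 * lam - 1) * dougall lam (a - 1) b (c + 1) =
      (a + b + lam) * ((b + c + 1) / (lam + (b + c : ℤ)) * dougall lam a b c +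
        (b + c + 2 * lam + 1) / (lam + (b + c + 2 : ℤ)) * dougall lam (a - 1) (b + 1) (c + 1)) := by
  by_cases hc' : c < -1
  · simp [dougall_eq_zero lam (a := a) (b := b + 1) (c := c) (by omega),
      dougall_eq_zero lam (a := a - 1) (b := b) (c := c + 1) (by omega),
      dougall_eq_zero lam (a := a) (b := b) (c := c) (by omega),
      dougall_eq_zero lam (a := a - 1) (b := b + 1) (c := c + 1) (by omega)]
  by_cases hb' : b < -1
  · simp [dougall_eq_zero lam (a := a) (b := b + 1) (c := c) (by omega),
      dougall_eq_zero lam (a := a - 1) (b := b) (c := c + 1) (by omega),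
      dougall_eq_zero lam (a := a) (b := b) (c := c) (by omega),
      dougall_eq_zero lam (a := a - 1) (b := b + 1) (c := c + 1) (by omega)]
  have nz {j : ℤ} (hj : 0 ≤ j) : lam + j ≠ 0 := add_intCast_ne_zero (by linarith) h2 hj
  have nz2 {j : ℤ} (hj : 0 ≤ j) : 2 * lam + j ≠ 0 :=
    add_intCast_ne_zero (by linarith) (by simpa using h2) hj
  have nz2' {j : ℤ} (hj : 0 ≤ j) : lam * 2 + j ≠ 0 := mul_comm lam 2 ▸ nz2 hj
  have pos {j : ℤ} (hj : 0 ≤ j) : (j : ℝ) + 1 ≠ 0 := by exact_mod_cast (by omega : j + 1 ≠ 0)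
  rcases ha.eq_or_lt with rfl | ha
  · rw [dougall_eq_zero lam (a := 0 - 1) (by omega), dougall_eq_zero lam (a := 0 - 1) (by omega)]
    by_cases hb : b < 0
    · obtain rfl : b = -1 := by omega
      rw [dougall_eq_zero lam (b := -1) (by omega)]
      simp
    by_cases hc : c < 0
    · rw [dougall_eq_zero lam (c := c) (by omega), dougall_eq_zero lam (c := c) (by omega)]
      simp
    push Not at hb hc
    have hS : 0 ≤ b + c := by omega
    have e1 := nz hS
    have e2 := nz2 hS
    have e2' := nz2' hS
    have e3 := nz (j := b + c + 1) (by omega)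
    have e4 := pos hb
    have e5 := nz2 (j := b + c + 1) (by omega)
    have e5' := nz2' (j := b + c + 1) (by omega)
    simp only [dougall, pochDivFact_succ lam hb]
    rw [show (0 : ℤ) + (b + 1) + c = b + c + 1 by ring, show (b + 1) + c = b + c + 1 by ring,
      show 0 + b + c = b + c by ring, pochRatio_succ h1 h2 hS, factDivPoch_succ h1 h2 hS]
    push_cast at *
    field_simp
    ring
  obtain ⟨a, rfl⟩ : ∃ a', a = a' + 1 := ⟨a - 1, by ring⟩
  rw [add_sub_cancel_right]
  replace ha : 0 ≤ a := by omega
  have ea := pos ha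
  by_cases hb : b < 0
  · obtain rfl : b = -1 := by omega
    rw [dougall_eq_zero lam (b := -1) (by omega), dougall_eq_zero lam (b := -1) (by omega)]
    have hc : 0 ≤ c := by omega
    have e1 := nz hc
    have e2 := nz (j := c + 1) (by omega)
    have e3 := nz2 hc
    have e3' := nz2' hc
    have e4 := pos hc
    have e5 := nz (j := a + c + 1) (by omega)
    simp only [dougall, pochDivFact_succ lam ha, pochDivFact_succ lam hc]
    rw [show a + 1 + (-1 + 1) + c = a + c + 1 by ring, show -1 + 1 + c = c by ring,
      show a + (-1 + 1) + (c + 1) = a + c + 1 by ring, show -1 + 1 + (c + 1) = c + 1 by ring,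
      show -1 + c + 2 = c + 1 by ring,
      factDivPoch_succ h1 h2 hc]
    push_cast at *
    norm_num [pochDivFact_zero] at *
    field_simp
    ring
  by_cases hc : c < 0
  · obtain rfl : c = -1 := by omega
    rw [dougall_eq_zero lam (c := -1) (by omega), dougall_eq_zero lam (c := -1) (by omega)]
    push Not at hb
    have e1 := nz hb
    have e2 := nz (j := b + 1) (by omega)
    have e3 := nz2 hb
    have e3' := nz2' hb
    have e4 := pos hb
    have e5 := nz (j := a + b) (by omega)
    have e6 := nz (j := a + b + 1) (by omega)
    simp only [dougall, pochDivFact_succ lam hb]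
    rw [show a + b + (-1 + 1) = a + b by ring, show b + (-1 + 1) = b by ring,
      show a + (b + 1) + (-1 + 1) = a + b + 1 by ring, show b + 1 + (-1 + 1) = b + 1 by ring,
      show b + -1 + 2 = b + 1 by ring,
      factDivPoch_succ h1 h2 hb, pochRatio_succ h1 h2 (by omega : 0 ≤ a + b)]
    push_cast at *
    norm_num [pochDivFact_zero] at *
    field_simp
    ring
  push Not at hb hc
  have e1 := nz (j := b + c) (by omega)
  have e2 := nz (j := b + c + 1) (by omega)
  have e3 := nz (j := b + c + 2) (by omega)
  have e4 := nz2 (j := b + c) (by omega)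
  have e4' := nz2' (j := b + c) (by omega)
  have e5 := nz2 (j := b + c + 1) (by omega)
  have e5' := nz2' (j := b + c + 1) (by omega)
  have e6 := pos hb
  have e7 := pos hc
  have e8 := nz (j := a + b + c + 1) (by omega)
  have e9 := nz (j := a + b + c + 1 + 1) (by omega)
  simp only [dougall, pochDivFact_succ lam ha, pochDivFact_succ lam hb, pochDivFact_succ lam hc]
  rw [show a + 1 + (b + 1) + c = a + b + c + 1 + 1 by ring,
    show b + 1 + c = b + c + 1 by ring,
    show a + b + (c + 1) = a + b + c + 1 by ring, show b + (c + 1) = b + c + 1 by ring,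
    show a + 1 + b + c = a + b + c + 1 by ring,
    show a + (b + 1) + (c + 1) = a + b + c + 1 + 1 by ring,
    show b + 1 + (c + 1) = b + c + 1 + 1 by ring,
    pochRatio_succ h1 h2 (by omega : 0 ≤ a + b + c + 1),
    factDivPoch_succ h1 h2 (by omega : 0 ≤ b + c + 1),
    factDivPoch_succ h1 h2 (by omega : 0 ≤ b + c)]
  push_cast at *
  rw [show (b : ℝ) + c + 1 + 1 = b + c + 2 by ring]
  field_simp
  ring

section GegenbauerPolynomials

open Polynomial

/-- The Gegenbauer polynomials `C_n^λ`, defined by their three-term recurrence. -/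
noncomputable def gegPoly (lam : ℝ) : ℕ → ℝ[X]
  | 0 => 1
  | 1 => C (2 * lam) * X
  | n + 2 => C (1 / ((n : ℝ) + 2)) *
      (C (2 * (n + 1 + lam)) * X * gegPoly lam (n + 1) - C (n + 2 * lam) * gegPoly lam n)

theorem degree_gegPoly {lam : ℝ} (h1 : -(1 / 2) < lam) (h2 : lam ≠ 0) (n : ℕ) :
    (gegPoly lam n).degree = n := by
  induction n using Nat.twoStepInduction with
  | zero => simp [gegPoly]
  | one => simp [gegPoly, h2]
  | more n ih0 ih1 =>
    have hn : (n : ℝ) + 2 ≠ 0 := by positivity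
    have hl : 2 * ((n : ℝ) + 1 + lam) ≠ 0 := by
      have : (0 : ℝ) ≤ n := n.cast_nonneg
      linarith
    have hd : (C (2 * ((n : ℝ) + 1 + lam)) * X * gegPoly lam (n + 1)).degree =
        ((n + 2 : ℕ) : WithBot ℕ) := by
      rw [degree_mul, degree_C_mul_X hl, ih1]
      norm_cast
      ring
    have hlt : (C ((n : ℝ) + 2 * lam) * gegPoly lam n).degree <
        (C (2 * ((n : ℝ) + 1 + lam)) * X * gegPoly lam (n + 1)).degree := by
      rw [hd]
      refine lt_of_le_of_lt ((degree_mul_le _ _).trans (add_le_add degree_C_le ih0.le)) ?_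
      rw [zero_add]
      exact_mod_cast (by omega : n < n + 2)
    rw [gegPoly, degree_mul, degree_C (one_div_ne_zero hn), zero_add,
      degree_sub_eq_left_of_degree_lt hlt, hd]

/-- The Gegenbauer polynomials with the convention `C_n^λ = 0` for `n < 0`. -/
noncomputable def gegPolyZ (lam : ℝ) (n : ℤ) : ℝ[X] :=
  if 0 ≤ n then gegPoly lam n.toNat else 0

theorem gegPolyZ_of_neg (lam : ℝ) {n : ℤ} (hn : n < 0) : gegPolyZ lam n = 0 := by
  simp [gegPolyZ, hn]

theorem gegPolyZ_natCast (lam : ℝ) (n : ℕ) : gegPolyZ lam n = gegPoly lam n := by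
  simp [gegPolyZ]

theorem gegPolyZ_zero (lam : ℝ) : gegPolyZ lam 0 = 1 := by
  simp [gegPolyZ, gegPoly]

theorem X_mul_gegPolyZ (lam : ℝ) {n : ℤ} (hn : 0 ≤ n) :
    C (2 * (n + lam)) * X * gegPolyZ lam n =
      C ((n : ℝ) + 1) * gegPolyZ lam (n + 1) + C (n + 2 * lam - 1) * gegPolyZ lam (n - 1) := by
  lift n to ℕ using hn
  cases n with
  | zero => simp [gegPolyZ, gegPoly]
  | succ n =>
    have hn : (n : ℝ) + 2 ≠ 0 := by positivity
    rw [show ((n + 1 : ℕ) : ℤ) + 1 = (n + 2 : ℕ) by push_cast; ring,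
      show ((n + 1 : ℕ) : ℤ) - 1 = n by push_cast; ring]
    simp only [gegPolyZ_natCast]
    rw [gegPoly, ← mul_assoc, ← C_mul]
    push_cast
    rw [show ((n : ℝ) + 1 + 1) * (1 / (n + 2)) = 1 by field_simp; ring,
      show (n : ℝ) + 1 + 2 * lam - 1 = n + 2 * lam by ring, C_1]
    ring

theorem two_mul_X_mul_dougall_mul_gegPolyZ {lam : ℝ} (h1 : -(1 / 2) < lam) (h2 : lam ≠ 0)
    (a b c : ℤ) :
    C 2 * X * (C (dougall lam a b c) * gegPolyZ lam (b + c)) =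
      C ((b + c + 1) / (lam + (b + c : ℤ)) * dougall lam a b c) * gegPolyZ lam (b + c + 1) +
      C ((b + c + 2 * lam - 1) / (lam + (b + c : ℤ)) * dougall lam a b c) *
        gegPolyZ lam (b + c - 1) := by
  by_cases h : b < 0 ∨ c < 0
  · simp [dougall_eq_zero lam (a := a) (Or.inr h)]
  have hbc : 0 ≤ b + c := by omega
  have hne := add_intCast_ne_zero (by linarith) h2 hbc
  have hX := X_mul_gegPolyZ lam hbc
  calc _ = C (dougall lam a b c / (lam + (b + c : ℤ))) *
        (C (2 * ((b + c : ℤ) + lam)) * X * gegPolyZ lam (b + c)) := by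
        have : dougall lam a b c =
            dougall lam a b c / (lam + (b + c : ℤ)) * (((b + c : ℤ) : ℝ) + lam) := by
          rw [add_comm _ lam, div_mul_cancel₀ _ hne]
        conv_lhs => rw [this]
        rw [C_mul, C_mul]
        ring
    _ = _ := by
        rw [hX, mul_add, ← mul_assoc, ← mul_assoc, ← C_mul, ← C_mul]
        congr 3 <;> (push_cast; ring_nf)

theorem gegPolyZ_mul_succ {lam : ℝ} (h1 : -(1 / 2) < lam) (h2 : lam ≠ 0) {m n : ℤ} {N : ℕ}
    (hm : 0 ≤ m) (hN : m + 1 < N)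
    (ih0 : gegPolyZ lam (m - 1) * gegPolyZ lam n = ∑ j ∈ Finset.range N,
      C (dougall lam j (m - 1 - j) (n - j)) * gegPolyZ lam (m - 1 + n - 2 * j))
    (ih1 : gegPolyZ lam m * gegPolyZ lam n = ∑ j ∈ Finset.range N,
      C (dougall lam j (m - j) (n - j)) * gegPolyZ lam (m + n - 2 * j)) :
    gegPolyZ lam (m + 1) * gegPolyZ lam n = ∑ j ∈ Finset.range N,
      C (dougall lam j (m + 1 - j) (n - j)) * gegPolyZ lam (m + 1 + n - 2 * j) := by
  have hm1 : (m : ℝ) + 1 ≠ 0 := by exact_mod_cast (by omega : m + 1 ≠ 0)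
  refine mul_left_cancel₀ (C_ne_zero.mpr hm1) ?_
  set f : ℤ → ℝ[X] := fun j =>
    C ((m + lam) * ((m - j + (n - j) + 2 * lam + 1) / (lam + (m - j + (n - j) + 2 : ℤ)) *
        dougall lam (j - 1) (m - j + 1) (n - j + 1)) -
      (m + 2 * lam - 1) * dougall lam (j - 1) (m - j) (n - j + 1)) *
        gegPolyZ lam (m - j + (n - j) + 1) with hf
  have hf0 : f (0 : ℕ) = 0 := by
    simp [hf, dougall_eq_zero lam (a := -1) (Or.inl (by norm_num))]
  have hfN : f N = 0 := by
    simp only [hf]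
    rw [dougall_eq_zero lam (by omega), dougall_eq_zero lam (by omega)]
    simp
  have hshift : ∑ j ∈ Finset.range N, f ((j + 1 : ℕ) : ℤ) = ∑ j ∈ Finset.range N, f j := by
    have h := Finset.sum_range_succ (fun j : ℕ => f j) N
    rw [Finset.sum_range_succ', hfN, hf0, add_zero, add_zero] at h
    exact h
  calc _ = C ((m : ℝ) + lam) * (C 2 * X * (gegPolyZ lam m * gegPolyZ lam n)) -
        C (m + 2 * lam - 1) * (gegPolyZ lam (m - 1) * gegPolyZ lam n) := by
        have h := X_mul_gegPolyZ lam hm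
        rw [C_mul] at h
        linear_combination -gegPolyZ lam n * h
    _ = ∑ j ∈ Finset.range N, C ((m + lam) * ((m - j + (n - j) + 1) /
          (lam + (m - j + (n - j) : ℤ)) * dougall lam j (m - j) (n - j))) *
            gegPolyZ lam (m - j + (n - j) + 1) + ∑ j ∈ Finset.range N, f ((j + 1 : ℕ) : ℤ) := by
        rw [ih0, ih1, Finset.mul_sum, Finset.mul_sum, Finset.mul_sum, ← Finset.sum_sub_distrib,
          ← Finset.sum_add_distrib]
        refine Finset.sum_congr rfl fun j _ => ?_
        have h := two_mul_X_mul_dougall_mul_gegPolyZ h1 h2 j (m - j) (n - j)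
        rw [show m + n - 2 * (j : ℤ) = m - j + (n - j) by ring, h]
        simp only [hf]
        rw [show m - ((j + 1 : ℕ) : ℤ) + (n - ((j + 1 : ℕ) : ℤ)) + 1 = m - j + (n - j) - 1 by
            push_cast; ring,
          show m - 1 + n - 2 * (j : ℤ) = m - j + (n - j) - 1 by ring,
          show m - ((j + 1 : ℕ) : ℤ) + (n - ((j + 1 : ℕ) : ℤ)) + 2 = m - j + (n - j) by
            push_cast; ring,
          show m - ((j + 1 : ℕ) : ℤ) + 1 = m - j by push_cast; ring,
          show n - ((j + 1 : ℕ) : ℤ) + 1 = n - j by push_cast; ring,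
          show m - ((j + 1 : ℕ) : ℤ) = m - 1 - j by push_cast; ring,
          show ((j + 1 : ℕ) : ℤ) - 1 = j by push_cast; ring]
        rw [show (m : ℝ) - ((j + 1 : ℕ) : ℤ) + (n - ((j + 1 : ℕ) : ℤ)) + 2 * lam + 1 =
          ((m - j : ℤ) : ℝ) + (n - j : ℤ) + 2 * lam - 1 by push_cast; ring]
        simp only [C_mul, C_sub]
        push_cast
        ring
    _ = _ := by
        rw [hshift, ← Finset.sum_add_distrib, Finset.mul_sum]
        refine Finset.sum_congr rfl fun j _ => ?_
        rw [show m + 1 + n - 2 * (j : ℤ) = m - j + (n - j) + 1 by ring]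
        by_cases hneg : m - j + (n - j) + 1 < 0
        · simp [hf, gegPolyZ_of_neg lam hneg]
        have h := dougall_contiguous h1 h2 (a := j) (b := m - j) (c := n - j) (by omega) (by omega)
        simp only [hf]
        rw [← add_mul, ← C_add, ← mul_assoc (C ((m : ℝ) + 1)), ← C_mul]
        congr 2
        rw [show m + 1 - (j : ℤ) = m - j + 1 by ring]
        push_cast at h ⊢
        rw [add_sub_cancel] at h
        linear_combination -h

/-- Dougall's linearization formula for the product of two Gegenbauer polynomials. -/
theorem gegPolyZ_mul {lam : ℝ} (h1 : -(1 / 2) < lam) (h2 : lam ≠ 0) (m n : ℤ) {N : ℕ}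
    (hN : m < N) :
    gegPolyZ lam m * gegPolyZ lam n =
      ∑ j ∈ Finset.range N, C (dougall lam j (m - j) (n - j)) * gegPolyZ lam (m + n - 2 * j) := by
  have of_neg {m : ℤ} (N : ℕ) (h : m < 0) : gegPolyZ lam m * gegPolyZ lam n =
      ∑ j ∈ Finset.range N,
        C (dougall lam j (m - j) (n - j)) * gegPolyZ lam (m + n - 2 * j) := by
    rw [gegPolyZ_of_neg lam h, zero_mul, Finset.sum_eq_zero]
    intro j _
    rw [dougall_eq_zero lam (by omega), C_0, zero_mul]
  by_cases hn : n < 0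
  · rw [gegPolyZ_of_neg lam hn, mul_zero, Finset.sum_eq_zero]
    intro j _
    rw [dougall_eq_zero lam (by omega), C_0, zero_mul]
  push Not at hn
  by_cases hm : m < 0
  · exact of_neg N hm
  lift m to ℕ using not_lt.mp hm
  clear hm
  induction m using Nat.strong_induction_on generalizing N with
  | _ m ih =>
    cases m with
    | zero =>
      have hne := add_intCast_ne_zero (lam := lam) (by linarith) h2 hn
      have hp := pochZ_ne_zero (a := 2 * lam) (by linarith) (by simpa using h2) hn
      have hq := pochZ_ne_zero (by linarith) h2 hn
      have hi := ifact_ne_zero hn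
      rw [Finset.sum_eq_single_of_mem 0 (Finset.mem_range.mpr (by omega))]
      · have : dougall lam 0 0 n = 1 := by
          simp only [dougall, pochDivFact_zero, zero_add, one_mul]
          rw [div_self hne, pochDivFact, pochRatio, factDivPoch]
          field_simp
        simp [gegPolyZ_zero, this]
      · intro j _ hj
        rw [dougall_eq_zero lam (by omega), C_0, zero_mul]
    | succ m =>
      push_cast at hN ⊢
      refine gegPolyZ_mul_succ h1 h2 (by omega) hN ?_ (ih m (by omega) (by omega))
      cases m with
      | zero => exact of_neg N (by norm_num)
      | succ m =>
        push_cast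
        rw [add_sub_cancel_right]
        exact ih m (by omega) (by push_cast at hN; omega)

/-- The Gegenbauer polynomials as a polynomial sequence. -/
noncomputable def gegSequence {lam : ℝ} (h1 : -(1 / 2) < lam) (h2 : lam ≠ 0) :
    Polynomial.Sequence ℝ where
  elems' := gegPoly lam
  degree_eq' := degree_gegPoly h1 h2

/-- The coefficient of `C_l^λ` in the expansion of a polynomial in Gegenbauer polynomials. -/
noncomputable def gegCoord {lam : ℝ} (h1 : -(1 / 2) < lam) (h2 : lam ≠ 0) (l : ℕ) :
    ℝ[X] →ₗ[ℝ] ℝ :=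
  ((gegSequence h1 h2).basis fun i =>
    (leadingCoeff_ne_zero.mpr ((gegSequence h1 h2).ne_zero i)).isUnit).coord l

theorem gegCoord_gegPoly {lam : ℝ} (h1 : -(1 / 2) < lam) (h2 : lam ≠ 0) (l n : ℕ) :
    gegCoord h1 h2 l (gegPoly lam n) = if n = l then 1 else 0 := by
  have h := (gegSequence h1 h2).basis_eq_self (fun i =>
    (leadingCoeff_ne_zero.mpr ((gegSequence h1 h2).ne_zero i)).isUnit) n
  rw [show gegPoly lam n = gegSequence h1 h2 n from rfl, ← h, gegCoord, Module.Basis.coord_apply,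
    Module.Basis.repr_self, Finsupp.single_apply]

theorem gegCoord_gegPolyZ {lam : ℝ} (h1 : -(1 / 2) < lam) (h2 : lam ≠ 0) (l : ℕ) (n : ℤ) :
    gegCoord h1 h2 l (gegPolyZ lam n) = if n = l then 1 else 0 := by
  by_cases hn : 0 ≤ n
  · lift n to ℕ using hn
    simp [gegPolyZ_natCast, gegCoord_gegPoly]
  · rw [gegPolyZ_of_neg lam (by omega), map_zero, if_neg (by omega)]

theorem gegPoly_induction {lam : ℝ} (h1 : -(1 / 2) < lam) (h2 : lam ≠ 0) {f g : ℝ[X] →ₗ[ℝ] ℝ}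
    (h : ∀ n : ℕ, f (gegPolyZ lam n) = g (gegPolyZ lam n)) : f = g := by
  refine ((gegSequence h1 h2).basis fun i =>
    (leadingCoeff_ne_zero.mpr ((gegSequence h1 h2).ne_zero i)).isUnit).ext fun n => ?_
  rw [Polynomial.Sequence.basis_eq_self]
  simp only [gegPolyZ_natCast] at h
  exact h n

/-- The coefficients of `2x f(x)` in terms of those of `f`. -/
theorem gegCoord_X_mul {lam : ℝ} (h1 : -(1 / 2) < lam) (h2 : lam ≠ 0) (l : ℕ) (f : ℝ[X]) :
    2 * gegCoord h1 h2 l (X * f) =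
      (2 * lam + l) / (lam + l + 1) * gegCoord h1 h2 (l + 1) f +
        l / (lam + l - 1) * gegCoord h1 h2 (l - 1) f := by
  suffices h : (2 : ℝ) • (gegCoord h1 h2 l ∘ₗ LinearMap.mulLeft ℝ X) =
      ((2 * lam + l) / (lam + l + 1)) • gegCoord h1 h2 (l + 1) +
        (l / (lam + l - 1)) • gegCoord h1 h2 (l - 1) by
    simpa using LinearMap.congr_fun h f
  refine gegPoly_induction h1 h2 fun n => ?_
  have hn : ((n : ℤ) : ℝ) + lam ≠ 0 := by
    rw [add_comm]
    exact add_intCast_ne_zero (by linarith) h2 (by omega)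
  have hX := congrArg (gegCoord h1 h2 l) (X_mul_gegPolyZ lam (Int.natCast_nonneg n))
  rw [mul_assoc, ← smul_eq_C_mul, ← smul_eq_C_mul, ← smul_eq_C_mul] at hX
  simp only [map_add, map_smul, gegCoord_gegPolyZ, smul_eq_mul] at hX
  simp only [LinearMap.smul_apply, LinearMap.comp_apply, LinearMap.mulLeft_apply,
    LinearMap.add_apply, gegCoord_gegPolyZ, smul_eq_mul]
  rw [← mul_right_inj' hn]
  rw [mul_left_comm, ← mul_assoc, hX]
  rcases Nat.lt_trichotomy n l with h | h | h
  · obtain ⟨l, rfl⟩ : ∃ k, l = k + 1 := ⟨l - 1, by omega⟩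
    rw [if_neg (by omega : ¬ (n : ℤ) - 1 = (l + 1 : ℕ)),
      if_neg (by omega : ¬ (n : ℤ) = (l + 1 + 1 : ℕ))]
    by_cases hl : n = l
    · subst hl
      rw [if_pos (by push_cast; ring), if_pos (by simp)]
      push_cast at hn ⊢
      rw [show lam + ((n : ℝ) + 1) - 1 = n + lam by ring]
      field_simp
      ring
    · rw [if_neg (by omega), if_neg (by omega)]
      ring
  · subst h
    rw [if_neg (by omega), if_neg (by omega), if_neg (by omega)]
    rcases Nat.eq_zero_or_pos n with rfl | hpos
    · simp
    · rw [if_neg (by omega)]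
      ring
  · rw [if_neg (by omega : ¬ (n : ℤ) + 1 = l), if_neg (by omega : ¬ (n : ℤ) = (l - 1 : ℕ))]
    by_cases hl : n = l + 1
    · subst hl
      rw [if_pos (by push_cast; ring), if_pos rfl]
      push_cast at hn ⊢
      rw [show lam + (l : ℝ) + 1 = l + 1 + lam by ring]
      field_simp
      ring
    · rw [if_neg (by omega), if_neg (by omega)]
      ring

/-- Dougall's formula as a statement about coefficients. -/
theorem gegCoord_mul {lam : ℝ} (h1 : -(1 / 2) < lam) (h2 : lam ≠ 0) {m n i : ℤ} {l : ℕ}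
    (hl : (l : ℤ) = m + n - 2 * i) :
    gegCoord h1 h2 l (gegPolyZ lam m * gegPolyZ lam n) = dougall lam i (m - i) (n - i) := by
  obtain ⟨N, hN⟩ : ∃ N : ℕ, m < N := ⟨m.toNat + 1, by omega⟩
  rw [gegPolyZ_mul h1 h2 m n hN]
  simp only [← smul_eq_C_mul, map_sum, map_smul, gegCoord_gegPolyZ, smul_eq_mul]
  by_cases hi : 0 ≤ i ∧ i < N
  · obtain ⟨hi0, hi⟩ := hi
    lift i to ℕ using hi0
    rw [Finset.sum_eq_single_of_mem i (Finset.mem_range.mpr (by omega)), if_pos hl.symm, mul_one]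
    intro j _ hj
    rw [if_neg (by omega), mul_zero]
  · rw [dougall_eq_zero lam (by omega), Finset.sum_eq_zero]
    intro j hj
    rw [Finset.mem_range] at hj
    rw [if_neg (by omega), mul_zero]

/-- The coefficients of a product of three Gegenbauer polynomials. -/
theorem gegCoord_mul_mul {lam : ℝ} (h1 : -(1 / 2) < lam) (h2 : lam ≠ 0) {k p m n : ℤ} {l N : ℕ}
    (hN : m < N) (hl : (l : ℤ) = p + m + n - 2 * k) :
    gegCoord h1 h2 l (gegPolyZ lam p * gegPolyZ lam m * gegPolyZ lam n) =
      ∑ j ∈ Finset.range N, dougall lam j (m - j) (n - j) *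
        dougall lam (k - j) (m + n - k - j) (p - k + j) := by
  rw [mul_assoc, mul_comm, gegPolyZ_mul h1 h2 m n hN, Finset.sum_mul, map_sum]
  refine Finset.sum_congr rfl fun j _ => ?_
  rw [mul_assoc, ← smul_eq_C_mul, map_smul, smul_eq_mul,
    gegCoord_mul h1 h2 (i := k - j) (by omega)]
  congr 2 <;> ring

end GegenbauerPolynomials

/-- The ratio of `dougall lam (a + 1) b c` and `dougall lam a (b + 1) (c + 1)`. -/
noncomputable def dougallRatioLeft (lam a b c : ℝ) : ℝ :=
  (lam + (b + c)) * ((lam + a) * (b + 1) * (c + 1) * (lam + (a + b + c + 2)) *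
      (2 * lam + (b + c + 1)) * (2 * lam + (b + c))) /
    ((lam + (b + c + 2)) * ((a + 1) * (lam + b) * (lam + c) *
      (2 * lam + (a + b + c + 1)) * ((b + c + 2) * (b + c + 1))))

/-- The ratio of `dougall lam a b (c + 1)` and `dougall lam (a + 1) (b + 1) c`. -/
noncomputable def dougallRatioRight (lam a b c : ℝ) : ℝ :=
  (lam + (a + b + c + 2)) * ((a + 1) * (b + 1) * (lam + c)) /
    ((2 * lam + (a + b + c + 1)) * ((lam + a) * (lam + b) * (c + 1)))

/-- The ratio of the consecutive terms with indices `j + 1` and `j` of the sum of products of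
Dougall's coefficients. -/
noncomputable def tripleRatio (lam k p m n j : ℝ) : ℝ :=
  dougallRatioLeft lam j (m - (j + 1)) (n - (j + 1)) *
    dougallRatioRight lam (k - (j + 1)) (m + n - k - (j + 1)) (p - k + j)

/-- The summands in the coefficient of a product of three Gegenbauer polynomials. -/
noncomputable def tripleTerm (lam : ℝ) (k p m n j : ℤ) : ℝ :=
  dougall lam j (m - j) (n - j) * dougall lam (k - j) (m + n - k - j) (p - k + j)

theorem tripleTerm_eq_zero (lam : ℝ) {k p m n j : ℤ}
    (h : j < 0 ∨ m < j ∨ n < j ∨ k < j ∨ m + n - k < j ∨ p - k + j < 0) :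
    tripleTerm lam k p m n j = 0 := by
  by_cases h' : j < 0 ∨ m - j < 0 ∨ n - j < 0
  · rw [tripleTerm, dougall_eq_zero lam h', zero_mul]
  · rw [tripleTerm, dougall_eq_zero lam (a := k - j) (by omega), mul_zero]

theorem dougall_succ_left {lam : ℝ} (h1 : -(1 / 2) < lam) (h2 : lam ≠ 0) {a b c : ℤ}
    (ha : 0 ≤ a) (hb : 0 ≤ b) (hc : 0 ≤ c) :
    dougall lam (a + 1) b c = dougall lam a (b + 1) (c + 1) * dougallRatioLeft lam a b c := by
  have nz {j : ℤ} (hj : 0 ≤ j) : lam + j ≠ 0 := add_intCast_ne_zero (by linarith) h2 hj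
  have nz2 {j : ℤ} (hj : 0 ≤ j) : 2 * lam + j ≠ 0 :=
    add_intCast_ne_zero (by linarith) (by simpa using h2) hj
  have pos {j : ℤ} (hj : 0 ≤ j) : (j : ℝ) + 1 ≠ 0 := by exact_mod_cast (by omega : j + 1 ≠ 0)
  have e1 := nz hb
  have e2 := nz hc
  have e3 := pos ha
  have e4 := pos hb
  have e5 := pos hc
  have e6 := nz (j := b + c + 2) (by omega)
  have e7 := nz2 (j := a + b + c + 1) (by omega)
  have e8 := nz2 (j := b + c + 1) (by omega)
  have e9 := nz2 (j := b + c) (by omega)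
  have e10 := pos (j := b + c) (by omega)
  have e11 := pos (j := b + c + 1) (by omega)
  have e12 := nz (j := a + b + c + 1) (by omega)
  have e13 := nz (j := a + b + c + 2) (by omega)
  simp only [dougall, dougallRatioLeft, pochDivFact_succ lam ha, pochDivFact_succ lam hb,
    pochDivFact_succ lam hc]
  rw [show a + 1 + b + c = a + b + c + 1 by ring,
    show a + (b + 1) + (c + 1) = a + b + c + 1 + 1 by ring,
    show b + 1 + (c + 1) = b + c + 1 + 1 by ring,
    pochRatio_succ h1 h2 (by omega : 0 ≤ a + b + c + 1),
    factDivPoch_succ h1 h2 (by omega : 0 ≤ b + c + 1),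
    factDivPoch_succ h1 h2 (by omega : 0 ≤ b + c),
    show a + b + c + 1 + 1 = a + b + c + 2 by ring, show b + c + 1 + 1 = b + c + 2 by ring]
  push_cast at *
  rw [show (b : ℝ) + c + 1 + 1 = b + c + 2 by ring] at *
  generalize lam + (b : ℝ) = x1 at *
  generalize lam + (c : ℝ) = x2 at *
  generalize lam + (b + c + 2 : ℝ) = x3 at *
  generalize lam + (a + b + c + 2 : ℝ) = x4 at *
  generalize lam + (a + b + c + 1 : ℝ) = x5 at *
  generalize 2 * lam + (a + b + c + 1 : ℝ) = x6 at *
  generalize 2 * lam + (b + c + 1 : ℝ) = x7 at *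
  generalize 2 * lam + (b + c : ℝ) = x8 at *
  generalize (b + c + 2 : ℝ) = x9 at *
  generalize (b + c + 1 : ℝ) = x10 at *
  generalize lam + (b + c : ℝ) = x11 at *
  generalize (a + 1 : ℝ) = x12 at *
  generalize (b + 1 : ℝ) = x13 at *
  generalize (c + 1 : ℝ) = x14 at *
  generalize lam + (a : ℝ) = x15 at *
  field_simp

theorem dougall_succ_right {lam : ℝ} (h1 : -(1 / 2) < lam) (h2 : lam ≠ 0) {a b c : ℤ}
    (ha : 0 ≤ a) (hb : 0 ≤ b) (hc : 0 ≤ c) :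
    dougall lam a b (c + 1) = dougall lam (a + 1) (b + 1) c * dougallRatioRight lam a b c := by
  have nz {j : ℤ} (hj : 0 ≤ j) : lam + j ≠ 0 := add_intCast_ne_zero (by linarith) h2 hj
  have nz2 {j : ℤ} (hj : 0 ≤ j) : 2 * lam + j ≠ 0 :=
    add_intCast_ne_zero (by linarith) (by simpa using h2) hj
  have nz2' {j : ℤ} (hj : 0 ≤ j) : lam * 2 + j ≠ 0 := mul_comm lam 2 ▸ nz2 hj
  have pos {j : ℤ} (hj : 0 ≤ j) : (j : ℝ) + 1 ≠ 0 := by exact_mod_cast (by omega : j + 1 ≠ 0)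
  have e1 := nz ha
  have e2 := nz hb
  have e3 := pos ha
  have e4 := pos hb
  have e5 := pos hc
  have e7 := nz2 (j := a + b + c + 1) (by omega)
  have e7' := nz2' (j := a + b + c + 1) (by omega)
  have e12 := nz (j := a + b + c + 1) (by omega)
  have e13 := nz (j := a + b + c + 2) (by omega)
  simp only [dougall, dougallRatioRight, pochDivFact_succ lam ha, pochDivFact_succ lam hb,
    pochDivFact_succ lam hc]
  rw [show a + b + (c + 1) = a + b + c + 1 by ring,
    show a + 1 + (b + 1) + c = a + b + c + 1 + 1 by ring,
    show b + 1 + c = b + c + 1 by ring, show b + (c + 1) = b + c + 1 by ring,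
    pochRatio_succ h1 h2 (by omega : 0 ≤ a + b + c + 1),
    show a + b + c + 1 + 1 = a + b + c + 2 by ring]
  push_cast at *
  field_simp

theorem tripleTerm_succ {lam : ℝ} (h1 : -(1 / 2) < lam) (h2 : lam ≠ 0) {k p m n j : ℤ}
    (hj : 0 ≤ j) (hm : j + 1 ≤ m) (hn : j + 1 ≤ n) (hk : j + 1 ≤ k) (hmn : j + 1 ≤ m + n - k)
    (hp : 0 ≤ p - k + j) :
    tripleTerm lam k p m n (j + 1) = tripleTerm lam k p m n j * tripleRatio lam k p m n j := by
  have hl := dougall_succ_left h1 h2 hj (b := m - (j + 1)) (c := n - (j + 1)) (by omega) (by omega)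
  have hr := dougall_succ_right h1 h2 (a := k - (j + 1)) (b := m + n - k - (j + 1))
    (c := p - k + j) (by omega) (by omega) hp
  rw [show m - (j + 1) + 1 = m - j by ring, show n - (j + 1) + 1 = n - j by ring] at hl
  rw [show k - (j + 1) + 1 = k - j by ring, show p - k + j + 1 = p - k + (j + 1) by ring,
    show m + n - k - (j + 1) + 1 = m + n - k - j by ring] at hr
  rw [tripleTerm, tripleTerm, hl, hr, mul_mul_mul_comm, tripleRatio]
  push_cast
  rfl

/-- The summands of a generalized hypergeometric sum with argument `1`. -/
noncomputable def hypTerm (a b : List ℝ) (j : ℕ) : ℝ :=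
  (a.map fun t => poch t j).prod / ((b.map fun t => poch t j).prod * (j.factorial : ℝ))

theorem hypSum_one (a b : List ℝ) : hypSum a b 1 = ∑' j, hypTerm a b j := by
  simp [hypSum, hypTerm]

theorem hypTerm_zero (a b : List ℝ) : hypTerm a b 0 = 1 := by
  simp [hypTerm, poch_zero_right]

theorem hypTerm_succ (a b : List ℝ) (j : ℕ) : hypTerm a b (j + 1) = hypTerm a b j *
    ((a.map fun t => t + (j : ℝ)).prod / ((b.map fun t => t + (j : ℝ)).prod * (j + 1))) := by
  simp only [hypTerm, poch_succ, List.prod_map_mul, Nat.factorial_succ]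
  push_cast
  rw [div_mul_div_comm]
  congr 1
  ring

theorem hypTerm_eq_zero {a : List ℝ} (b : List ℝ) {t : ℝ} {K j : ℕ} (ht : t = -(K : ℝ))
    (h : K < j) (hta : t ∈ a) : hypTerm a b j = 0 := by
  rw [hypTerm, List.prod_eq_zero (List.mem_map.2 ⟨t, hta, poch_neg_eq_zero ht h⟩), zero_div]

theorem tripleRatio_eq {lam k p m n j a₁ a₂ a₃ a₄ a₅ a₆ a₇ a₈ a₉ a₁₀ a₁₁
    b₁ b₂ b₃ b₄ b₅ b₆ b₇ b₈ b₉ b₁₀ b₁₁ : ℝ}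
    (ha₇ : lam + (j + (m - (j + 1)) + (n - (j + 1)) + 2) = -a₇)
    (hb₆ : 2 * lam + (j + (m - (j + 1)) + (n - (j + 1)) + 1) = -b₆)
    (ha₁₀ : 2 * lam + (m - (j + 1) + (n - (j + 1)) + 1) = -2 * a₁₀)
    (ha₁₁ : 2 * lam + (m - (j + 1) + (n - (j + 1))) = -2 * a₁₁)
    (hb₈ : lam + (m - (j + 1) + (n - (j + 1)) + 2) = -2 * b₈)
    (ha₉ : lam + (m - (j + 1) + (n - (j + 1))) = -2 * a₉)
    (hb₉ : m - (j + 1) + (n - (j + 1)) + 2 = -2 * b₉)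
    (hb₁₀ : m - (j + 1) + (n - (j + 1)) + 1 = -2 * b₁₀)
    (ha₈ : lam + (k - (j + 1) + (m + n - k - (j + 1)) + (p - k + j) + 2) = -a₈)
    (hb₇ : 2 * lam + (k - (j + 1) + (m + n - k - (j + 1)) + (p - k + j) + 1) = -b₇)
    (ha₁ : lam + j = a₁) (ha₂ : lam + (p - k + j) = a₂) (ha₃ : k - (j + 1) + 1 = -a₃)
    (ha₄ : m - (j + 1) + 1 = -a₄) (ha₅ : n - (j + 1) + 1 = -a₅)
    (ha₆ : m + n - k - (j + 1) + 1 = -a₆) (hb₁ : p - k + j + 1 = b₁)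
    (hb₂ : lam + (k - (j + 1)) = -b₂) (hb₃ : lam + (m - (j + 1)) = -b₃)
    (hb₄ : lam + (n - (j + 1)) = -b₄) (hb₅ : lam + (m + n - k - (j + 1)) = -b₅)
    (hb₁₁ : j + 1 = b₁₁) :
    a₁ * (a₂ * (a₃ * (a₄ * (a₅ * (a₆ * (a₇ * (a₈ * (a₉ * (a₁₀ * a₁₁))))))))) /
        (b₁ * (b₂ * (b₃ * (b₄ * (b₅ * (b₆ * (b₇ * (b₈ * (b₉ * b₁₀)))))))) * b₁₁) =
      tripleRatio lam k p m n j := by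
  rw [tripleRatio, dougallRatioLeft, dougallRatioRight, ha₇, hb₆, ha₁₀, ha₁₁, hb₈, ha₉, hb₉, hb₁₀,
    ha₈, hb₇, ha₁, ha₂, ha₃, ha₄, ha₅, ha₆, hb₁, hb₂, hb₃, hb₄, hb₅, hb₁₁]
  clear * -
  ring

theorem gegD_ratio (lam k p m n j : ℝ) :
    ([lam, lam + p - k, -k, -m, -n, -m - n + k, -lam - m - n, -lam - m - n - p + k,
        (-lam + 2 - m - n) / 2, (-2 * lam + 1 - m - n) / 2,
        (-2 * lam + 2 - m - n) / 2].map fun t => t + j).prod /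
      (([1 + p - k, -lam + 1 - k, -lam + 1 - m, -lam + 1 - n, -lam + 1 - m - n + k,
        -2 * lam + 1 - m - n, -2 * lam + 1 - m - n - p + k, (-lam - m - n) / 2, (-m - n) / 2,
        (1 - m - n) / 2].map fun t => t + j).prod * (j + 1)) = tripleRatio lam k p m n j := by
  simp only [List.map_cons, List.map_nil, List.prod_cons, List.prod_nil, mul_one]
  apply tripleRatio_eq <;> ring

theorem gegE_ratio (lam k p m n j : ℝ) :
    ([lam, lam + k - p, -p, -m - p + k, -n - p + k, -m - n - p + 2 * k, -lam - m - n - p + k,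
        -lam - m - n - 2 * p + 2 * k, (-lam + 2 * k - 2 * p - m - n + 2) / 2,
        (-2 * lam + 1 + 2 * k - 2 * p - m - n) / 2,
        (-2 * lam + 2 + 2 * k - 2 * p - m - n) / 2].map fun t => t + j).prod /
      (([1 + k - p, -lam + 1 - p, -lam + 1 - m - p + k, -lam + 1 - n - p + k,
        -lam + 1 - m - n - p + 2 * k, -2 * lam + 1 - m - n - p + k,
        -2 * lam + 1 - m - n - 2 * p + 2 * k, (-lam + 2 * k - 2 * p - m - n) / 2,
        (2 * k - 2 * p - m - n) / 2,
        (1 + 2 * k - 2 * p - m - n) / 2].map fun t => t + j).prod * (j + 1)) =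
      tripleRatio lam k p m n (k - p + j) := by
  simp only [List.map_cons, List.map_nil, List.prod_cons, List.prod_nil, mul_one]
  have h (x y : ℝ) : x * y * (j + 1) = (j + 1) * y * x := by ring
  rw [mul_left_comm (lam + j), h]
  apply tripleRatio_eq <;> ring

theorem mul_hypSum_one {a b : List ℝ} {c : ℝ} {u : ℕ → ℝ} (h0 : c = u 0)
    (hs : ∀ j : ℕ, u (j + 1) = u j * ((a.map fun t => t + (j : ℝ)).prod /
      ((b.map fun t => t + (j : ℝ)).prod * (j + 1))) ∨
        u (j + 1) = 0 ∧ hypTerm a b (j + 1) = 0) :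
    c * hypSum a b 1 = ∑' j, u j := by
  rw [hypSum_one, ← tsum_mul_left]
  congr 1
  ext j
  induction j with
  | zero => rw [hypTerm_zero, mul_one, h0]
  | succ j ih =>
    rcases hs j with h | ⟨h, h'⟩
    · rw [hypTerm_succ, ← mul_assoc, ih, h]
    · rw [h, h', mul_zero]

theorem gegD_eq_tsum {lam : ℝ} (h1 : -(1 / 2) < lam) (h2 : lam ≠ 0) {k p m n : ℤ} (hk : 0 ≤ k)
    (hp : k ≤ p) : gegD lam k p m n = ∑' j : ℕ, tripleTerm lam k p m n j := by
  by_cases hr : m < 0 ∨ n < 0 ∨ m + n - k < 0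
  · have h (j : ℕ) : tripleTerm lam k p m n j = 0 := tripleTerm_eq_zero lam (by omega)
    simp only [h, tsum_zero]
    rcases hr with hr | hr | hr <;> simp [gegD, ifact_of_neg hr]
  push Not at hr
  obtain ⟨hm, hn, hmn⟩ := hr
  refine mul_hypSum_one ?_ fun j => ?_
  · have e1 := add_intCast_ne_zero (lam := lam) (j := m + n) (by linarith) h2 (by omega)
    have e2 := pochZ_ne_zero (a := 2 * lam) (j := m + n) (by linarith) (by simpa using h2)
      (by omega)
    simp only [tripleTerm, dougall, pochRatio, factDivPoch, sub_zero, Nat.cast_zero,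
      pochDivFact_zero, add_zero, zero_add]
    rw [show k + (m + n - k) + (p - k) = m + n + p - k by ring,
      show m + n - k + (p - k) = m + n + p - 2 * k by ring]
    simp only [pochDivFact]
    have c1 : lam + m + n + p - 2 * k = lam + (m + n + p - 2 * k : ℤ) := by push_cast; ring
    have c2 : lam + m + n + p - k = lam + (m + n + p - k : ℤ) := by push_cast; ring
    rw [c1, c2]
    generalize lam + ((m + n : ℤ) : ℝ) = x1 at *
    generalize lam + ((m + n + p - 2 * k : ℤ) : ℝ) = x2 at *
    generalize lam + ((m + n + p - k : ℤ) : ℝ) = x3 at *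
    rw [div_self e1, div_mul_div_cancel₀' e2]
    ring
  by_cases hj : (j : ℤ) + 1 ≤ m ∧ (j : ℤ) + 1 ≤ n ∧ (j : ℤ) + 1 ≤ k ∧ (j : ℤ) + 1 ≤ m + n - k
  · left
    rw [gegD_ratio]
    have := tripleTerm_succ h1 h2 (j := j) (p := p) (by omega) hj.1 hj.2.1 hj.2.2.1 hj.2.2.2
      (by omega)
    push_cast at this ⊢
    exact this
  · right
    refine ⟨tripleTerm_eq_zero lam (by push_cast; omega), ?_⟩
    lift m to ℕ using hm
    lift n to ℕ using hn
    lift k to ℕ using hk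
    obtain ⟨q, hq⟩ := Int.eq_ofNat_of_zero_le hmn
    have hq' : -(m : ℝ) - n + k = -(q : ℝ) := by
      have := congrArg (Int.cast (R := ℝ)) hq
      push_cast at this
      linarith
    by_cases c1 : m < j + 1
    · exact hypTerm_eq_zero (t := -(m : ℝ)) _ rfl c1 (by simp)
    by_cases c2 : n < j + 1
    · exact hypTerm_eq_zero (t := -(n : ℝ)) _ rfl c2 (by simp)
    by_cases c3 : k < j + 1
    · exact hypTerm_eq_zero (t := -(k : ℝ)) _ rfl c3 (by simp)
    · exact hypTerm_eq_zero (t := -(m : ℝ) - n + k) _ hq' (by omega) (by simp)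

theorem gegE_eq_tsum {lam : ℝ} (h1 : -(1 / 2) < lam) (h2 : lam ≠ 0) {k p m n : ℤ} (hp : p ≤ k)
    (hk : 0 ≤ m + n + p - 2 * k) :
    gegE lam k p m n = ∑' j : ℕ, tripleTerm lam k p m n (k - p + j) := by
  by_cases hr : p < 0 ∨ m + p - k < 0 ∨ n + p - k < 0
  · have h (j : ℕ) : tripleTerm lam k p m n (k - p + j) = 0 := tripleTerm_eq_zero lam (by omega)
    simp only [h, tsum_zero]
    rcases hr with hr | hr | hr <;> simp [gegE, ifact_of_neg hr]
  push Not at hr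
  obtain ⟨hp0, hm, hn⟩ := hr
  refine mul_hypSum_one ?_ fun j => ?_
  · have e1 := add_intCast_ne_zero (lam := lam) (j := m + n + 2 * p - 2 * k) (by linarith) h2
      (by omega)
    have e2 := pochZ_ne_zero (a := 2 * lam) (j := m + n + 2 * p - 2 * k) (by linarith)
      (by simpa using h2) (by omega)
    have e3 := ifact_ne_zero hk
    simp only [tripleTerm, dougall, Nat.cast_zero, add_zero]
    rw [show k - (k - p) = p by ring, show m - (k - p) = m + p - k by ring,
      show n - (k - p) = n + p - k by ring, show m + n - k - (k - p) = m + n + p - 2 * k by ring,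
      show p - k + (k - p) = 0 by ring, add_zero, add_zero,
      show k - p + (m + p - k) + (n + p - k) = m + n + p - k by ring,
      show m + p - k + (n + p - k) = m + n + 2 * p - 2 * k by ring,
      show p + (m + n + p - 2 * k) = m + n + 2 * p - 2 * k by ring, pochDivFact_zero]
    simp only [pochRatio, factDivPoch, pochDivFact]
    have c1 : lam + m + n + p - 2 * k = lam + (m + n + p - 2 * k : ℤ) := by push_cast; ring
    have c2 : lam + m + n + p - k = lam + (m + n + p - k : ℤ) := by push_cast; ring
    rw [c1, c2]
    generalize lam + ((m + n + 2 * p - 2 * k : ℤ) : ℝ) = x1 at *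
    generalize lam + ((m + n + p - 2 * k : ℤ) : ℝ) = x2 at *
    generalize lam + ((m + n + p - k : ℤ) : ℝ) = x3 at *
    generalize pochZ (2 * lam) (m + n + 2 * p - 2 * k) = x4 at *
    generalize pochZ (2 * lam) (m + n + p - 2 * k) = x5 at *
    generalize pochZ (2 * lam) (m + n + p - k) = x6 at *
    generalize ifact (m + n + p - 2 * k) = x7 at *
    calc
      _ = _ * (x1 * x1⁻¹ * (x4 * x4⁻¹) * (x7 * x7⁻¹)) := by
        rw [mul_inv_cancel₀ e1, mul_inv_cancel₀ e2, mul_inv_cancel₀ e3, mul_one, mul_one, mul_one]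
      _ = _ := by ring
  by_cases hj : (j : ℤ) + 1 ≤ m + p - k ∧ (j : ℤ) + 1 ≤ n + p - k ∧ (j : ℤ) + 1 ≤ p ∧
      (j : ℤ) + 1 ≤ m + n + p - 2 * k
  · left
    rw [gegE_ratio]
    have := tripleTerm_succ h1 h2 (j := k - p + j) (k := k) (p := p) (m := m) (n := n) (by omega)
      (by omega) (by omega) (by omega) (by omega) (by omega)
    push_cast [add_assoc] at this ⊢
    exact this
  · right
    refine ⟨tripleTerm_eq_zero lam (by push_cast; omega), ?_⟩
    obtain ⟨p', hp'⟩ := Int.eq_ofNat_of_zero_le hp0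
    obtain ⟨m', hm'⟩ := Int.eq_ofNat_of_zero_le hm
    obtain ⟨n', hn'⟩ := Int.eq_ofNat_of_zero_le hn
    obtain ⟨q, hq⟩ := Int.eq_ofNat_of_zero_le hk
    have ep := congrArg (Int.cast (R := ℝ)) hp'
    have em := congrArg (Int.cast (R := ℝ)) hm'
    have en := congrArg (Int.cast (R := ℝ)) hn'
    have eq := congrArg (Int.cast (R := ℝ)) hq
    push_cast at ep em en eq
    by_cases c1 : m' < j + 1
    · exact hypTerm_eq_zero (t := -(m : ℝ) - p + k) _ (by linarith) c1 (by simp)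
    by_cases c2 : n' < j + 1
    · exact hypTerm_eq_zero (t := -(n : ℝ) - p + k) _ (by linarith) c2 (by simp)
    by_cases c3 : p' < j + 1
    · exact hypTerm_eq_zero (t := -(p : ℝ)) _ (by linarith) c3 (by simp)
    · exact hypTerm_eq_zero (t := -(m : ℝ) - n - p + 2 * k) (K := q) _ (by linarith) (by omega)
        (by simp)

theorem gegF_eq_gegCoord {lam : ℝ} (h1 : -(1 / 2) < lam) (h2 : lam ≠ 0) {k p m n : ℤ} {l : ℕ}
    (hk : 0 ≤ k) (hl : (l : ℤ) = p + m + n - 2 * k) :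
    gegF lam k p m n = gegCoord h1 h2 l (gegPolyZ lam p * gegPolyZ lam m * gegPolyZ lam n) := by
  have hN : m < (m.toNat + 1 : ℕ) := by omega
  rw [gegCoord_mul_mul h1 h2 hN hl]
  have hsum (j : ℕ) (hj : j ∉ Finset.range (m.toNat + 1)) : tripleTerm lam k p m n j = 0 :=
    tripleTerm_eq_zero lam (by rw [Finset.mem_range] at hj; omega)
  change _ = ∑ j ∈ Finset.range (m.toNat + 1), tripleTerm lam k p m n j
  rw [gegF]
  split_ifs with hkp hkp'
  · rw [gegD_eq_tsum h1 h2 hk (by omega), tsum_eq_sum hsum]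
  · rw [gegE_eq_tsum h1 h2 hkp'.1 (by omega)]
    obtain ⟨d, hd⟩ := Int.eq_ofNat_of_zero_le (sub_nonneg.2 hkp'.1)
    rw [← tsum_eq_sum (L := .unconditional ℕ) hsum, hd]
    have hinj : Function.Injective fun j : ℕ => d + j := add_right_injective d
    rw [← hinj.tsum_eq (f := fun j : ℕ => tripleTerm lam k p m n j)]
    · push_cast
      rfl
    · intro j hj
      by_contra hj'
      refine hj (tripleTerm_eq_zero lam ?_)
      by_contra hc
      exact hj' ⟨j - d, by simp only; omega⟩
  · refine absurd ⟨by omega, ?_⟩ hkp'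
    rw [Int.fdiv_eq_ediv_of_nonneg _ (by norm_num)]
    omega

/-- The relation between contiguous coefficients in terms of the variable times a product of
Gegenbauer polynomials. -/
theorem gegCoord_contiguous {lam : ℝ} (h1 : -(1 / 2) < lam) (h2 : lam ≠ 0) (l : ℕ) {p : ℤ}
    (hp : 0 ≤ p) (f : Polynomial ℝ) :
    ((p : ℝ) + 1) * gegCoord h1 h2 l (gegPolyZ lam (p + 1) * f) +
        (p + 2 * lam - 1) * gegCoord h1 h2 l (gegPolyZ lam (p - 1) * f) =
      (p + lam) * (2 * gegCoord h1 h2 l (.X * (gegPolyZ lam p * f))) := by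
  have h := congrArg (fun q => gegCoord h1 h2 l (q * f)) (X_mul_gegPolyZ lam hp)
  simp only [add_mul, mul_assoc, Polynomial.C_mul', map_add, smul_mul_assoc, map_smul,
    smul_eq_mul] at h
  linarith

theorem stmt4 (p m n : ℕ) (hpm : p ≤ m) (hmn : m ≤ n)
    (lam : ℝ) (h1 : -(1 / 2) < lam) (h2 : lam ≠ 0)
    (l : ℕ) (hl : l ≤ p + m + n) (hodd : Odd ((p : ℤ) + m + n - l)) :
    (((m : ℝ) + lam) * ((p : ℝ) + 1) *
          gegF lam (((p : ℤ) + m + n - l + 1) / 2) ((p : ℤ) + 1) m n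
        + ((p : ℝ) + 2 * lam - 1) * ((m : ℝ) + lam) *
          gegF lam (((p : ℤ) + m + n - l - 1) / 2) ((p : ℤ) - 1) m n
      = ((p : ℝ) + lam) * ((m : ℝ) + 1) *
          gegF lam (((p : ℤ) + m + n - l + 1) / 2) p ((m : ℤ) + 1) n
        + ((p : ℝ) + lam) * ((m : ℝ) + 2 * lam - 1) *
          gegF lam (((p : ℤ) + m + n - l - 1) / 2) p ((m : ℤ) - 1) n) ∧
    (((n : ℝ) + lam) * ((p : ℝ) + 1) *
          gegF lam (((p : ℤ) + m + n - l + 1) / 2) ((p : ℤ) + 1) m n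
        + ((p : ℝ) + 2 * lam - 1) * ((n : ℝ) + lam) *
          gegF lam (((p : ℤ) + m + n - l - 1) / 2) ((p : ℤ) - 1) m n
      = ((p : ℝ) + lam) * ((n : ℝ) + 1) *
          gegF lam (((p : ℤ) + m + n - l + 1) / 2) p m ((n : ℤ) + 1)
        + ((p : ℝ) + lam) * ((n : ℝ) + 2 * lam - 1) *
          gegF lam (((p : ℤ) + m + n - l - 1) / 2) p m ((n : ℤ) - 1)) ∧
    (((p : ℝ) + 1) * gegF lam (((p : ℤ) + m + n - l + 1) / 2) ((p : ℤ) + 1) m n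
        + ((p : ℝ) + 2 * lam - 1) *
          gegF lam (((p : ℤ) + m + n - l - 1) / 2) ((p : ℤ) - 1) m n
      = (2 * lam + (l : ℝ)) * ((p : ℝ) + lam) / (lam + (l : ℝ) + 1) *
          gegF lam (((p : ℤ) + m + n - l - 1) / 2) p m n
        + (l : ℝ) * ((p : ℝ) + lam) / (lam + (l : ℝ) - 1) *
          gegF lam (((p : ℤ) + m + n - l + 1) / 2) p m n) ∧
    (((n : ℝ) + lam) * ((m : ℝ) + 1) *
          gegF lam (((p : ℤ) + m + n - l + 1) / 2) p ((m : ℤ) + 1) n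
        + ((m : ℝ) + 2 * lam - 1) * ((n : ℝ) + lam) *
          gegF lam (((p : ℤ) + m + n - l - 1) / 2) p ((m : ℤ) - 1) n
      = ((m : ℝ) + lam) * ((n : ℝ) + 1) *
          gegF lam (((p : ℤ) + m + n - l + 1) / 2) p m ((n : ℤ) + 1)
        + ((m : ℝ) + lam) * ((n : ℝ) + 2 * lam - 1) *
          gegF lam (((p : ℤ) + m + n - l - 1) / 2) p m ((n : ℤ) - 1)) ∧
    (((m : ℝ) + 1) * gegF lam (((p : ℤ) + m + n - l + 1) / 2) p ((m : ℤ) + 1) n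
        + ((m : ℝ) + 2 * lam - 1) *
          gegF lam (((p : ℤ) + m + n - l - 1) / 2) p ((m : ℤ) - 1) n
      = (2 * lam + (l : ℝ)) * ((m : ℝ) + lam) / (lam + (l : ℝ) + 1) *
          gegF lam (((p : ℤ) + m + n - l - 1) / 2) p m n
        + (l : ℝ) * ((m : ℝ) + lam) / (lam + (l : ℝ) - 1) *
          gegF lam (((p : ℤ) + m + n - l + 1) / 2) p m n) ∧
    (((n : ℝ) + 1) * gegF lam (((p : ℤ) + m + n - l + 1) / 2) p m ((n : ℤ) + 1)
        + ((n : ℝ) + 2 * lam - 1) *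
          gegF lam (((p : ℤ) + m + n - l - 1) / 2) p m ((n : ℤ) - 1)
      = (2 * lam + (l : ℝ)) * ((n : ℝ) + lam) / (lam + (l : ℝ) + 1) *
          gegF lam (((p : ℤ) + m + n - l - 1) / 2) p m n
        + (l : ℝ) * ((n : ℝ) + lam) / (lam + (l : ℝ) - 1) *
          gegF lam (((p : ℤ) + m + n - l + 1) / 2) p m n) := by
  obtain ⟨t, ht⟩ := hodd
  have ht0 : 0 ≤ t := by omega
  have hs1 : ((p : ℤ) + m + n - l + 1) / 2 = t + 1 := by omega
  have hs2 : ((p : ℤ) + m + n - l - 1) / 2 = t := by omega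
  rw [hs1, hs2]
  set P := gegPolyZ lam
  set G := gegCoord h1 h2 l
  have F1 (a b c : ℤ) (h : (l : ℤ) = a + b + c - 2 * (t + 1)) :
      gegF lam (t + 1) a b c = G (P a * P b * P c) :=
    gegF_eq_gegCoord h1 h2 (by omega) h
  have F0 (a b c : ℤ) (h : (l : ℤ) = a + b + c - 2 * t) :
      gegF lam t a b c = G (P a * P b * P c) :=
    gegF_eq_gegCoord h1 h2 ht0 h
  rw [F1 (p + 1) m n (by omega), F0 (p - 1) m n (by omega), F1 p (m + 1) n (by omega),
    F0 p (m - 1) n (by omega), F1 p m (n + 1) (by omega), F0 p m (n - 1) (by omega)]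
  have hp := gegCoord_contiguous h1 h2 l (Int.natCast_nonneg p) (P m * P n)
  have hm := gegCoord_contiguous h1 h2 l (Int.natCast_nonneg m) (P p * P n)
  have hn := gegCoord_contiguous h1 h2 l (Int.natCast_nonneg n) (P p * P m)
  have hX := gegCoord_X_mul h1 h2 l (P p * P m * P n)
  rw [← gegF_eq_gegCoord h1 h2 (k := t) ht0 (by push_cast; omega)] at hX
  have hX' : (l : ℝ) / (lam + l - 1) * gegCoord h1 h2 (l - 1) (P p * P m * P n) =
      l / (lam + l - 1) * gegF lam (t + 1) p m n := by
    rcases Nat.eq_zero_or_pos l with rfl | hl0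
    · simp
    · rw [gegF_eq_gegCoord h1 h2 (k := t + 1) (l := l - 1) (by omega) (by omega)]
  rw [hX'] at hX
  rw [show P p * (P m * P n) = P p * P m * P n by ring, ← mul_assoc, ← mul_assoc] at hp
  rw [show P m * (P p * P n) = P p * P m * P n by ring,
    show P (m + 1) * (P p * P n) = P p * P (m + 1) * P n by ring,
    show P (m - 1) * (P p * P n) = P p * P (m - 1) * P n by ring] at hm
  rw [mul_comm (P n), mul_comm (P (n + 1)), mul_comm (P (n - 1))] at hn
  rw [hX] at hp hm hn
  simp only [Int.cast_natCast] at hp hm hn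
  refine ⟨?_, ?_, ?_, ?_, ?_, ?_⟩
  · linear_combination (m + lam) * hp - (p + lam) * hm
  · linear_combination (n + lam) * hp - (p + lam) * hn
  · linear_combination hp
  · linear_combination (n + lam) * hm - (m + lam) * hn
  · linear_combination hm
  · linear_combination hn
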